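/- The algebra ℰ_3(1) is semisimple of dimension 30 over ℂ; more precisely, it is isomorphic as a ℂ-algebra to the product ℂ × ℂ × ℂ × ℂ × M_2(ℂ) × M_2(ℂ) × M_3(ℂ) × M_3(ℂ) (equivalently, 4M_1(ℂ) ⊕ 2M_2(ℂ) ⊕ 2M_3(ℂ)). -/

import Mathlib

noncomputable section

open FreeAlgebra

/-- Generators of the algebra `ℰ_n(1)`: `T i` and `E i` for `i` ranging over
`n - 1` indices. -/
inductive Gen (n : ℕ) : Type
  | T : Fin (n - 1) → Gen n
  | E : Fin (n - 1) → Gen n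

/-- The free `ℂ`-algebra on the generators. -/
abbrev FA (n : ℕ) : Type := FreeAlgebra ℂ (Gen n)

def fT {n : ℕ} (i : Fin (n - 1)) : FA n := ι ℂ (Gen.T i)
def fE {n : ℕ} (i : Fin (n - 1)) : FA n := ι ℂ (Gen.E i)

/-- The defining relations of `ℰ_n(1)`. -/
inductive E1Rel (n : ℕ) : FA n → FA n → Prop
  | TTfar {i j : Fin (n - 1)} : 1 < Nat.dist i j →
      E1Rel n (fT i * fT j) (fT j * fT i)
  | braid {i j : Fin (n - 1)} : Nat.dist i j = 1 →
      E1Rel n (fT i * fT j * fT i) (fT j * fT i * fT j)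
  | Eidem (i : Fin (n - 1)) : E1Rel n (fE i * fE i) (fE i)
  | EE (i j : Fin (n - 1)) : E1Rel n (fE i * fE j) (fE j * fE i)
  | ET (i : Fin (n - 1)) : E1Rel n (fE i * fT i) (fT i * fE i)
  | ETfar {i j : Fin (n - 1)} : 1 < Nat.dist i j →
      E1Rel n (fE i * fT j) (fT j * fE i)
  | ETT {i j : Fin (n - 1)} : Nat.dist i j = 1 →
      E1Rel n (fE j * (fT i * fT j)) (fT i * fT j * fE i)
  | EET {i j : Fin (n - 1)} : Nat.dist i j = 1 →
      E1Rel n (fE i * fE j * fT j) (fE i * fT j * fE i)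
  | ETE {i j : Fin (n - 1)} : Nat.dist i j = 1 →
      E1Rel n (fE i * fT j * fE i) (fT j * (fE i * fE j))
  | Tsq (i : Fin (n - 1)) : E1Rel n (fT i * fT i) 1

/-- The algebra `ℰ_n(1)`. -/
abbrev En1 (n : ℕ) : Type := RingQuot (E1Rel n)

/-- The generator `T i` of `ℰ_n(1)`. -/
def T {n : ℕ} (i : Fin (n - 1)) : En1 n := RingQuot.mkAlgHom ℂ (E1Rel n) (fT i)

/-- The generator `E i` of `ℰ_n(1)`. -/
def E {n : ℕ} (i : Fin (n - 1)) : En1 n := RingQuot.mkAlgHom ℂ (E1Rel n) (fE i)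

namespace E3

abbrev M2 := Matrix (Fin 2) (Fin 2) ℂ
abbrev M3 := Matrix (Fin 3) (Fin 3) ℂ
abbrev R := ℂ × ℂ × ℂ × ℂ × M2 × M2 × M3 × M3

def r1 : R := (1, -1, 1, -1, !![-1, 1; 0, 1], !![-1, 1; 0, 1],
  !![1, 0, 0; 0, 0, 1; 0, 1, 0], !![-1, 0, 0; 0, 0, -1; 0, -1, 0])
def r2 : R := (1, -1, 1, -1, !![1, 0; 1, -1], !![1, 0; 1, -1],
  !![0, 0, 1; 0, 1, 0; 1, 0, 0], !![0, 0, -1; 0, -1, 0; -1, 0, 0])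
def p1 : R := (0, 0, 1, 1, !![0, 0; 0, 0], !![1, 0; 0, 1],
  !![1, 0, 0; 0, 0, 0; 0, 0, 0], !![1, 0, 0; 0, 0, 0; 0, 0, 0])
def p2 : R := (0, 0, 1, 1, !![0, 0; 0, 0], !![1, 0; 0, 1],
  !![0, 0, 0; 0, 1, 0; 0, 0, 0], !![0, 0, 0; 0, 1, 0; 0, 0, 0])
def one' : R := (1, 1, 1, 1, !![1, 0; 0, 1], !![1, 0; 0, 1],
  !![1, 0, 0; 0, 1, 0; 0, 0, 1], !![1, 0, 0; 0, 1, 0; 0, 0, 1])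

lemma one'_eq : (1 : R) = one' := by
  simp [one', Prod.ext_iff, Matrix.one_fin_two, Matrix.one_fin_three]

lemma z1 : (![0] : Fin 1 → ℂ) = 0 := by ext i; fin_cases i; rfl
lemma z2 : (![0, 0] : Fin 2 → ℂ) = 0 := by ext i; fin_cases i <;> rfl
lemma z3 : (![0, 0, 0] : Fin 3 → ℂ) = 0 := by ext i; fin_cases i <;> rfl
lemma z13 : (![0] : Fin 1 → Fin 3 → ℂ) = 0 := by ext i; fin_cases i; rfl
lemma z23 : (![0, 0] : Fin 2 → Fin 3 → ℂ) = 0 := by ext i; fin_cases i <;> rfl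

def gen : Gen 3 → R
  | Gen.T i => if i = (0 : Fin 2) then r1 else r2
  | Gen.E i => if i = (0 : Fin 2) then p1 else p2

def pre : FA 3 →ₐ[ℂ] R := FreeAlgebra.lift ℂ gen

lemma pre_T (i : Fin (3 - 1)) : pre (fT i) = if i = (0 : Fin 2) then r1 else r2 := by
  simp [pre, fT, gen]
lemma pre_E (i : Fin (3 - 1)) : pre (fE i) = if i = (0 : Fin 2) then p1 else p2 := by
  simp [pre, fE, gen]

lemma not_far (i j : Fin (3 - 1)) : ¬ (1 < Nat.dist i j) := by
  revert i j; decide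

lemma dist_one {i j : Fin (3 - 1)} (h : Nat.dist i j = 1) :
    (i = (0 : Fin 2) ∧ j = (1 : Fin 2)) ∨ (i = (1 : Fin 2) ∧ j = (0 : Fin 2)) := by
  revert i j; decide

lemma fin_cases2 (i : Fin (3 - 1)) : i = (0 : Fin 2) ∨ i = (1 : Fin 2) := by
  revert i; decide

lemma pre_rel {x y : FA 3} (h : E1Rel 3 x y) : pre x = pre y := by
  induction h with
  | TTfar h => exact absurd h (not_far _ _)
  | ETfar h => exact absurd h (not_far _ _)
  | braid h =>
    rcases dist_one h with ⟨rfl, rfl⟩ | ⟨rfl, rfl⟩ <;>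
      simp [pre_T, r1, r2]
  | Eidem i => rcases fin_cases2 i with rfl | rfl <;> simp [pre_E, p1, p2, z1, z2, z3, z13, z23]
  | EE i j =>
    rcases fin_cases2 i with rfl | rfl <;> rcases fin_cases2 j with rfl | rfl <;>
      simp [pre_E, p1, p2, z1, z2, z3, z13, z23]
  | ET i => rcases fin_cases2 i with rfl | rfl <;> simp [pre_E, pre_T, p1, p2, r1, r2, z1, z2, z3, z13, z23]
  | ETT h =>
    rcases dist_one h with ⟨rfl, rfl⟩ | ⟨rfl, rfl⟩ <;>
      simp [pre_T, pre_E, r1, r2, p1, p2, z1, z2, z3, z13, z23]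
  | EET h =>
    rcases dist_one h with ⟨rfl, rfl⟩ | ⟨rfl, rfl⟩ <;>
      simp [pre_T, pre_E, r1, r2, p1, p2, z1, z2, z3, z13, z23]
  | ETE h =>
    rcases dist_one h with ⟨rfl, rfl⟩ | ⟨rfl, rfl⟩ <;>
      simp [pre_T, pre_E, r1, r2, p1, p2, z1, z2, z3, z13, z23]
  | Tsq i =>
    rw [map_one, one'_eq]
    rcases fin_cases2 i with rfl | rfl <;> simp [pre_T, r1, r2, one']

def φ : En1 3 →ₐ[ℂ] R := RingQuot.liftAlgHom ℂ ⟨pre, fun _ _ h => pre_rel h⟩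

abbrev t1 : En1 3 := T (n := 3) (0 : Fin 2)
abbrev t2 : En1 3 := T (n := 3) (1 : Fin 2)
abbrev e1 : En1 3 := E (n := 3) (0 : Fin 2)
abbrev e2 : En1 3 := E (n := 3) (1 : Fin 2)

lemma φ_t1 : φ t1 = r1 := by simp [φ, T, pre_T]
lemma φ_t2 : φ t2 = r2 := by simp [φ, T, pre_T]
lemma φ_e1 : φ e1 = p1 := by simp [φ, E, pre_E]
lemma φ_e2 : φ e2 = p2 := by simp [φ, E, pre_E]

/-! ### Surjectivity -/

lemma r12 : r1 * r2 = (1, 1, 1, 1, !![0, -1; 1, -1], !![0, -1; 1, -1],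
    !![0, 0, 1; 1, 0, 0; 0, 1, 0], !![0, 0, 1; 1, 0, 0; 0, 1, 0]) := by
  simp [r1, r2]
lemma r21 : r2 * r1 = (1, 1, 1, 1, !![-1, 1; -1, 0], !![-1, 1; -1, 0],
    !![0, 1, 0; 0, 0, 1; 1, 0, 0], !![0, 1, 0; 0, 0, 1; 1, 0, 0]) := by
  simp [r1, r2]
lemma r121 : r1 * r2 * r1 = (1, -1, 1, -1, !![0, -1; -1, 0], !![0, -1; -1, 0],
    !![0, 1, 0; 1, 0, 0; 0, 0, 1], !![0, -1, 0; -1, 0, 0; 0, 0, -1]) := by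
  simp [r1, r2]
lemma p12 : p1 * p2 = (0, 0, 1, 1, !![0, 0; 0, 0], !![1, 0; 0, 1],
    !![0, 0, 0; 0, 0, 0; 0, 0, 0], !![0, 0, 0; 0, 0, 0; 0, 0, 0]) := by
  simp [p1, p2, z1, z2, z3, z13, z23]
lemma p13 : r1 * p2 * r1 = (0, 0, 1, 1, !![0, 0; 0, 0], !![1, 0; 0, 1],
    !![0, 0, 0; 0, 0, 0; 0, 0, 1], !![0, 0, 0; 0, 0, 0; 0, 0, 1]) := by
  simp [r1, p2, z1, z2, z3, z13, z23]

/-- A general element of the group algebra part. -/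
def gcomb {A : Type} [Ring A] [Algebra ℂ A] (x y : A) (a b c d e f : ℂ) : A :=
  a • 1 + b • x + c • y + d • (x * y) + e • (y * x) + f • (x * y * x)

lemma gcomb_r (a b c d e f : ℂ) : gcomb r1 r2 a b c d e f =
    (a + b + c + d + e + f, a - b - c + d + e - f, a + b + c + d + e + f, a - b - c + d + e - f,
      !![a - b + c - e, b - d + e - f; c + d - e - f, a + b - c - d],
      !![a - b + c - e, b - d + e - f; c + d - e - f, a + b - c - d],
      !![a + b, e + f, c + d; d + f, a + c, b + e; c + e, b + d, a + f],
      !![a - b, e - f, d - c; d - f, a - c, e - b; e - c, d - b, a - f]) := by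
  simp only [gcomb, r12, r21, r121, one'_eq]
  simp [r1, r2, one', Prod.ext_iff, ← Matrix.ext_iff, Fin.forall_fin_succ]
  refine ⟨?_, ?_, ?_, ?_⟩ <;> ring_nf <;> simp

lemma φ_gcomb (a b c d e f : ℂ) : φ (gcomb t1 t2 a b c d e f) = gcomb r1 r2 a b c d e f := by
  simp only [gcomb, map_add, map_smul, map_mul, map_one, φ_t1, φ_t2]

lemma φ_surj : Function.Surjective φ := by
  rintro ⟨a, b, c, d, M, N, P, Q⟩
  refine ⟨(1 - e1 - e2 - t1 * e2 * t1 + e1 * e2 + e1 * e2) * gcomb t1 t2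
      ((a + b + 2 * (M 0 0 + M 1 1)) / 6) ((a - b + 2 * (-M 0 0 + M 1 0 + M 1 1)) / 6)
      ((a - b + 2 * (M 0 0 + M 0 1 - M 1 1)) / 6) ((a + b + 2 * (-M 0 0 + M 1 0 - M 0 1)) / 6)
      ((a + b + 2 * (- M 1 0 + M 0 1 - M 1 1)) / 6) ((a - b + 2 * (- M 1 0 - M 0 1)) / 6)
    + (e1 * e2) * gcomb t1 t2
      ((c + d + 2 * (N 0 0 + N 1 1)) / 6) ((c - d + 2 * (-N 0 0 + N 1 0 + N 1 1)) / 6)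
      ((c - d + 2 * (N 0 0 + N 0 1 - N 1 1)) / 6) ((c + d + 2 * (-N 0 0 + N 1 0 - N 0 1)) / 6)
      ((c + d + 2 * (- N 1 0 + N 0 1 - N 1 1)) / 6) ((c - d + 2 * (- N 1 0 - N 0 1)) / 6)
    + (e1 - e1 * e2) * gcomb t1 t2 ((P 0 0 + Q 0 0) / 2) ((P 0 0 - Q 0 0) / 2)
      ((P 0 2 - Q 0 2) / 2) ((P 0 2 + Q 0 2) / 2) ((P 0 1 + Q 0 1) / 2) ((P 0 1 - Q 0 1) / 2)
    + (e2 - e1 * e2) * gcomb t1 t2 ((P 1 1 + Q 1 1) / 2) ((P 1 2 - Q 1 2) / 2)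
      ((P 1 1 - Q 1 1) / 2) ((P 1 0 + Q 1 0) / 2) ((P 1 2 + Q 1 2) / 2) ((P 1 0 - Q 1 0) / 2)
    + (t1 * e2 * t1 - e1 * e2) * gcomb t1 t2 ((P 2 2 + Q 2 2) / 2) ((P 2 1 - Q 2 1) / 2)
      ((P 2 0 - Q 2 0) / 2) ((P 2 1 + Q 2 1) / 2) ((P 2 0 + Q 2 0) / 2) ((P 2 2 - Q 2 2) / 2),
    ?_⟩
  have h0 : φ (1 - e1 - e2 - t1 * e2 * t1 + e1 * e2 + e1 * e2) = (1, 1, 0, 0, 1, 0, 0, 0) := by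
    simp only [map_add, map_sub, map_mul, map_one, φ_t1, φ_e1, φ_e2, p12, p13, one'_eq]
    simp [one', p1, p2, Prod.ext_iff, ← Matrix.ext_iff, Fin.forall_fin_succ]
  have hc : φ (e1 * e2) = (0, 0, 1, 1, 0, 1, 0, 0) := by
    simp only [map_mul, φ_e1, φ_e2, p12]
    simp [Prod.ext_iff, ← Matrix.ext_iff, Fin.forall_fin_succ]
  have h1 : φ (e1 - e1 * e2) = (0, 0, 0, 0, 0, 0, !![1, 0, 0; 0, 0, 0; 0, 0, 0],
      !![1, 0, 0; 0, 0, 0; 0, 0, 0]) := by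
    simp only [map_sub, map_mul, φ_e1, φ_e2, p12]
    simp [p1, z1, z2, z3, z13, z23]
  have h2 : φ (e2 - e1 * e2) = (0, 0, 0, 0, 0, 0, !![0, 0, 0; 0, 1, 0; 0, 0, 0],
      !![0, 0, 0; 0, 1, 0; 0, 0, 0]) := by
    simp only [map_sub, map_mul, φ_e1, φ_e2, p12]
    simp [p2, z1, z2, z3, z13, z23]
  have h3 : φ (t1 * e2 * t1 - e1 * e2) = (0, 0, 0, 0, 0, 0, !![0, 0, 0; 0, 0, 0; 0, 0, 1],
      !![0, 0, 0; 0, 0, 0; 0, 0, 1]) := by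
    simp only [map_sub, map_mul, φ_t1, φ_e1, φ_e2, p12, p13]
    simp [z1, z2, z3, z13, z23]
  rw [map_add, map_add, map_add, map_add, map_mul, map_mul φ (e1 * e2),
    map_mul φ (e1 - e1 * e2), map_mul φ (e2 - e1 * e2), map_mul φ (t1 * e2 * t1 - e1 * e2),
    h0, hc, h1, h2, h3]
  simp only [φ_gcomb, gcomb_r, Prod.mk_mul_mk, Prod.mk_add_mk, zero_mul, one_mul, add_zero,
    zero_add]
  simp only [Prod.mk.injEq]
  refine ⟨by ring, by ring, by ring, by ring, ?_, ?_, ?_, ?_⟩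
  · ext i j; fin_cases i <;> fin_cases j <;> simp <;> ring
  · ext i j; fin_cases i <;> fin_cases j <;> simp <;> ring
  · ext i j; fin_cases i <;> fin_cases j <;> simp <;> ring
  · ext i j; fin_cases i <;> fin_cases j <;> simp <;> ring

/-! ### The spanning set -/

lemma rel {x y : FA 3} (h : E1Rel 3 x y) :
    RingQuot.mkAlgHom ℂ (E1Rel 3) x = RingQuot.mkAlgHom ℂ (E1Rel 3) y :=
  RingQuot.mkAlgHom_rel ℂ h

lemma d01 : Nat.dist ((0 : Fin 2) : Fin (3 - 1)) ((1 : Fin 2) : Fin (3 - 1)) = 1 := by decide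
lemma d10 : Nat.dist ((1 : Fin 2) : Fin (3 - 1)) ((0 : Fin 2) : Fin (3 - 1)) = 1 := by decide

lemma sq (i : Fin (3 - 1)) : (T i * T i : En1 3) = 1 := by
  simpa [T] using rel (E1Rel.Tsq i)
lemma braid : t1 * t2 * t1 = t2 * t1 * t2 := by
  simpa [T] using rel (E1Rel.braid d01)
lemma idem (i : Fin (3 - 1)) : (E i * E i : En1 3) = E i := by
  simpa [E] using rel (E1Rel.Eidem i)
lemma comm12 : e2 * e1 = e1 * e2 := by
  simpa [E] using rel (E1Rel.EE (n := 3) (1 : Fin 2) (0 : Fin 2))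
lemma et (i : Fin (3 - 1)) : (E i * T i : En1 3) = T i * E i := by
  simpa [E, T] using rel (E1Rel.ET i)
lemma ett : e2 * (t1 * t2) = t1 * t2 * e1 := by
  simpa [E, T] using rel (E1Rel.ETT d01)
lemma ct2 : e1 * e2 * t2 = t2 * (e1 * e2) := by
  simpa [E, T] using (rel (E1Rel.EET d01)).trans (rel (E1Rel.ETE d01))
lemma ct1 : e1 * e2 * t1 = t1 * (e1 * e2) := by
  have : e2 * e1 * t1 = t1 * (e2 * e1) := by
    simpa [E, T] using (rel (E1Rel.EET d10)).trans (rel (E1Rel.ETE d10))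
  rwa [comm12] at this

def pp : Fin 5 → En1 3 := ![1, e1, e2, t1 * e2 * t1, e1 * e2]
def gg : Fin 6 → En1 3 := ![1, t1, t2, t1 * t2, t2 * t1, t1 * t2 * t1]

lemma s1 (x : En1 3) : t1 * (t1 * x) = x := by rw [← mul_assoc, sq, one_mul]
lemma s2 (x : En1 3) : t2 * (t2 * x) = x := by rw [← mul_assoc, sq, one_mul]
lemma ee (i : Fin (3 - 1)) (x : En1 3) : (E i * (E i * x) : En1 3) = E i * x := by
  rw [← mul_assoc, idem]

lemma ff : t1 * e2 * t1 = t2 * e1 * t2 := by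
  have h := congrArg (fun z => t2 * (t1 * z) * t1) ett
  have h := congrArg (fun z => t1 * z * t2) ett
  simp only [mul_assoc, s1, sq, mul_one] at h ⊢
  exact h

lemma t1_gg (k : Fin 6) : ∃ l, t1 * gg k = gg l := by
  fin_cases k
  · exact ⟨1, by simp [gg]⟩
  · exact ⟨0, by simp [gg, sq]⟩
  · exact ⟨3, by simp [gg]⟩
  · exact ⟨2, by simp [gg, s1]⟩
  · exact ⟨5, by simp [gg, mul_assoc]⟩
  · exact ⟨4, by simp [gg, mul_assoc, s1]⟩

lemma t2_gg (k : Fin 6) : ∃ l, t2 * gg k = gg l := by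
  fin_cases k
  · exact ⟨2, by simp [gg]⟩
  · exact ⟨4, by simp [gg]⟩
  · exact ⟨0, by simp [gg, sq]⟩
  · exact ⟨5, by simp [gg, braid]; simp [mul_assoc]⟩
  · exact ⟨1, by simp [gg, s2]⟩
  · exact ⟨3, by simp [gg, braid]; simp [mul_assoc, s2]⟩

lemma t1_pp (k : Fin 5) : ∃ l, t1 * pp k = pp l * t1 := by
  fin_cases k
  · exact ⟨0, by simp [pp]⟩
  · exact ⟨1, by simp [pp, et]⟩
  · exact ⟨3, by simp [pp, mul_assoc, sq]⟩
  · exact ⟨2, by simp [pp, mul_assoc, s1]⟩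
  · exact ⟨4, by simp [pp, ct1]⟩

lemma t2_pp (k : Fin 5) : ∃ l, t2 * pp k = pp l * t2 := by
  fin_cases k
  · exact ⟨0, by simp [pp]⟩
  · exact ⟨3, by simp [pp, ff]; simp [mul_assoc, sq]⟩
  · exact ⟨2, by simp [pp, et]⟩
  · exact ⟨1, by simp [pp, ff]; simp [mul_assoc, s2]⟩
  · exact ⟨4, by simp [pp, ct2]⟩

lemma e1_pp (k : Fin 5) : ∃ l, e1 * pp k = pp l := by
  fin_cases k
  · exact ⟨1, by simp [pp]⟩
  · exact ⟨1, by simp [pp, idem]⟩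
  · exact ⟨4, by simp [pp]⟩
  · refine ⟨4, ?_⟩
    have : e1 * (t1 * e2 * t1) = e1 * e2 := by
      rw [← mul_assoc, ← mul_assoc, et, mul_assoc, mul_assoc, ← mul_assoc e1, ct1, s1]
    simpa [pp] using this
  · exact ⟨4, by simp [pp, ee]⟩

lemma e2_pp (k : Fin 5) : ∃ l, e2 * pp k = pp l := by
  fin_cases k
  · exact ⟨2, by simp [pp]⟩
  · exact ⟨4, by simp [pp, comm12]⟩
  · exact ⟨2, by simp [pp, idem]⟩
  · refine ⟨4, ?_⟩
    have : e2 * (t1 * e2 * t1) = e1 * e2 := by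
      rw [ff, ← mul_assoc, ← mul_assoc, et, mul_assoc, mul_assoc, ← mul_assoc e2, comm12, ct2, s2]
    simpa [pp] using this
  · exact ⟨4, by simp [pp]; rw [← comm12, ee]⟩

def ww (k : Fin 5 × Fin 6) : En1 3 := pp k.1 * gg k.2

def W : Submodule ℂ (En1 3) := Submodule.span ℂ (Set.range ww)

lemma W_of {a : En1 3} (h : ∀ k, ∃ l, a * ww k = ww l) {x : En1 3} (hx : x ∈ W) : a * x ∈ W := by
  refine Submodule.span_induction (p := fun x _ => a * x ∈ W) ?_ ?_ ?_ ?_ hx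
  · rintro _ ⟨k, rfl⟩
    obtain ⟨l, hl⟩ := h k
    exact hl ▸ Submodule.subset_span ⟨l, rfl⟩
  · simp
  · intro x y _ _ hx hy
    rw [mul_add]; exact W.add_mem hx hy
  · intro c x _ hx
    rw [mul_smul_comm]; exact W.smul_mem c hx

lemma of_t {t : En1 3} (h1 : ∀ k, ∃ l, t * pp k = pp l * t) (h2 : ∀ k, ∃ l, t * gg k = gg l)
    (k) : ∃ l, t * ww k = ww l := by
  obtain ⟨l, hl⟩ := h1 k.1
  obtain ⟨m, hm⟩ := h2 k.2
  exact ⟨(l, m), by simp only [ww]; rw [← mul_assoc, hl, mul_assoc, hm]⟩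

lemma of_e {t : En1 3} (h1 : ∀ k, ∃ l, t * pp k = pp l) (k) : ∃ l, t * ww k = ww l := by
  obtain ⟨l, hl⟩ := h1 k.1
  exact ⟨(l, k.2), by simp only [ww]; rw [← mul_assoc, hl]⟩

lemma W_mul (a : FA 3) : ∀ x ∈ W, RingQuot.mkAlgHom ℂ (E1Rel 3) a * x ∈ W := by
  induction a using FreeAlgebra.induction with
  | grade0 r =>
    intro x hx
    rw [AlgHom.commutes, ← Algebra.smul_def]
    exact W.smul_mem r hx
  | grade1 g =>
    intro x hx
    rcases g with i | i
    · rcases fin_cases2 i with rfl | rfl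
      · exact W_of (a := t1) (of_t t1_pp t1_gg) hx
      · exact W_of (a := t2) (of_t t2_pp t2_gg) hx
    · rcases fin_cases2 i with rfl | rfl
      · exact W_of (a := e1) (of_e e1_pp) hx
      · exact W_of (a := e2) (of_e e2_pp) hx
  | mul a b ha hb =>
    intro x hx
    rw [map_mul, mul_assoc]
    exact ha _ (hb _ hx)
  | add a b ha hb =>
    intro x hx
    rw [map_add, add_mul]
    exact W.add_mem (ha _ hx) (hb _ hx)

lemma W_top : W = ⊤ := by
  rw [eq_top_iff]
  intro x _
  obtain ⟨a, rfl⟩ := RingQuot.mkAlgHom_surjective ℂ (E1Rel 3) x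
  have h1 : (1 : En1 3) ∈ W := Submodule.subset_span ⟨(0, 0), by simp [ww, pp, gg]⟩
  simpa using W_mul a 1 h1

lemma fin_A : Module.Finite ℂ (En1 3) :=
  ⟨by
    have h := W_top
    rw [← h]
    exact Submodule.fg_span (Set.finite_range ww)⟩

lemma finrank_le : Module.finrank ℂ (En1 3) ≤ 30 := by
  have h := finrank_range_le_card (R := ℂ) ww
  have hw : Submodule.span ℂ (Set.range ww) = ⊤ := W_top
  rw [Set.finrank, hw, finrank_top] at h
  simpa using h

lemma finrank_R : Module.finrank ℂ R = 30 := by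
  simp [R, Module.finrank_prod, Module.finrank_matrix]

lemma finrank_A : Module.finrank ℂ (En1 3) = 30 := by
  have := fin_A
  refine le_antisymm finrank_le ?_
  rw [← finrank_R]
  exact LinearMap.finrank_le_finrank_of_surjective (f := φ.toLinearMap) φ_surj

lemma φ_bij : Function.Bijective φ := by
  have := fin_A
  refine ⟨?_, φ_surj⟩
  exact (LinearMap.injective_iff_surjective_of_finrank_eq_finrank (f := φ.toLinearMap)
    (finrank_A.trans finrank_R.symm)).2 φ_surj

end E3

/-- `ℰ_3(1)` is a semisimple `ℂ`-algebra of dimension 30, isomorphic to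
`4 M_1(ℂ) ⊕ 2 M_2(ℂ) ⊕ 2 M_3(ℂ)`. -/
theorem stmt18 :
    IsSemisimpleRing (En1 3) ∧
    Module.finrank ℂ (En1 3) = 30 ∧
    Nonempty (En1 3 ≃ₐ[ℂ]
      (ℂ × ℂ × ℂ × ℂ ×
        Matrix (Fin 2) (Fin 2) ℂ × Matrix (Fin 2) (Fin 2) ℂ ×
        Matrix (Fin 3) (Fin 3) ℂ × Matrix (Fin 3) (Fin 3) ℂ)) := by
  exact ⟨(AlgEquiv.ofBijective E3.φ E3.φ_bij).symm.toRingEquiv.isSemisimpleRing, E3.finrank_A,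
    ⟨AlgEquiv.ofBijective E3.φ E3.φ_bij⟩⟩
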